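/- Let n be a natural number, K a symmetric n×n real matrix, b ∈ ℤⁿ an integer vector, m an even integer, and s a real number. Let M be the symmetric (n+2)×(n+2) real matrix with upper-left n×n block K, with M_{I,n+1} = M_{n+1,I} = b_I and M_{I,n+2} = M_{n+2,I} = 0 for I ≤ n, and with lower-right 2×2 block [[m − 2s, 1],[1, 0]]. Then there exists an (n+2)×(n+2) integer matrix W with det W = ±1 such that W M Wᵀ equals the block-diagonal matrix K ⊕ [[−2s, 1],[1, 0]] (the matrix with upper-left block K, lower-right block [[−2s, 1],[1, 0]], and zero off-diagonal blocks). -/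

import Mathlib

open Matrix

/-- Reversibility of the one-step hierarchy construction at the matrix level:
the matrix `K` bordered by an integer vector `b`, an even integer `m` shifted by `2s`,
and an undoing layer, is `GL(ℤ)`-congruent to `K ⊕ [[−2s, 1], [1, 0]]`. -/
theorem bordered_reduces_to_trivial_bilayer (n : ℕ) (K : Matrix (Fin n) (Fin n) ℝ)
    (hsym : K.IsSymm) (b : Fin n → ℤ) (m : ℤ) (hm : Even m) (s : ℝ)
    (B : Matrix (Fin n) (Fin 2) ℝ)
    (hB : B = Matrix.of fun i j => if j = 0 then (b i : ℝ) else 0)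
    (M : Matrix (Fin n ⊕ Fin 2) (Fin n ⊕ Fin 2) ℝ)
    (hM : M = Matrix.fromBlocks K B Bᵀ !![(m : ℝ) - 2 * s, 1; 1, 0]) :
    ∃ W : Matrix (Fin n ⊕ Fin 2) (Fin n ⊕ Fin 2) ℤ,
      (W.det = 1 ∨ W.det = -1) ∧
      (W.map (Int.cast : ℤ → ℝ)) * M * (W.map (Int.cast : ℤ → ℝ))ᵀ
        = Matrix.fromBlocks K 0 0 !![-(2 * s), 1; 1, 0] := by
  obtain ⟨k, rfl⟩ := hm
  subst hB hM
  refine ⟨fromBlocks 1 (of fun i j => if j = 0 then 0 else -b i) 0 !![1, -k; 0, 1],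
    Or.inl (by simp [det_fromBlocks_zero₂₁]), ?_⟩
  have h_one : (1 : Matrix (Fin n) (Fin n) ℤ).map (Int.cast : ℤ → ℝ) = 1 := by
    simp
  rw [fromBlocks_map, fromBlocks_transpose, fromBlocks_multiply, fromBlocks_multiply, h_one,
    fromBlocks_inj]
  simp only [Matrix.one_mul, Matrix.mul_one, transpose_one, Matrix.map_zero, Int.cast_zero,
    Matrix.zero_mul, transpose_zero, Matrix.mul_zero, zero_add]
  refine ⟨?_, ?_, ?_, ?_⟩
  · ext i j
    simp [Matrix.mul_apply, Fin.sum_univ_two]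
  · ext i j
    fin_cases j <;> simp [Matrix.mul_apply, Fin.sum_univ_two]
  · ext i j
    fin_cases i <;> simp [Matrix.mul_apply, Fin.sum_univ_two]
  · ext i j
    fin_cases i <;> fin_cases j <;> simp [Matrix.mul_apply, Fin.sum_univ_two]
    ring
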